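/- Suppose a stationary process under P_0 satisfies: for all ℓ' ≥ ℓ ≥ |k| and all k ≤ 0, E_0|H_k(Y_{−ℓ:0}) − H_k(Y_{−ℓ':0})| ≤ c·φ_{ℓ−|k|} and E_0|H_k(Y_{−ℓ:0}) − H_k(Y_{−ℓ:−1})| ≤ c·ψ_{|k|}, where Σφ and Σψ converge. Then the limits H_k(Y_{−∞:u}) exist in L^1(P_0) for u ∈ {−1,0}, the series Σ_{k=−∞}^{−1} E_0[H_k(Y_{−∞:0}) − H_k(Y_{−∞:−1})] converges absolutely, and |Σ_{k=−m}^{−1} E_0[H_k(Y_{−m:0}) − H_k(Y_{−m:−1})] − Σ_{k=−∞}^{−1} E_0[H_k(Y_{−∞:0}) − H_k(Y_{−∞:−1})]| ≤ c'·(Σ_{j≥⌈m/2⌉}φ_j + Σ_{j≥⌊m/2⌋}ψ_j) for some constant c'. -/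

import Mathlib

open MeasureTheory Filter

/-- An `L¹`-Cauchy sequence with modulus `b` converges in `L¹`, at rate `b`. -/
theorem exists_integrable_limit_of_integral_abs_sub_le
    {Ω : Type*} [MeasurableSpace Ω] {P : Measure Ω} {f : ℕ → Ω → ℝ}
    (hf : ∀ n, Integrable (f n) P) {b : ℕ → ℝ} (hb : Tendsto b atTop (nhds 0))
    (hfb : ∀ n n', n ≤ n' → ∫ ω, |f n ω - f n' ω| ∂P ≤ b n) :
    ∃ g : Ω → ℝ, Integrable g P
      ∧ Tendsto (fun n => ∫ ω, |f n ω - g ω| ∂P) atTop (nhds 0)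
      ∧ ∀ n, ∫ ω, |f n ω - g ω| ∂P ≤ b n := by
  have hdist : ∀ {u v : Ω → ℝ} (hu : Integrable u P) (hv : Integrable v P),
      dist (hu.toL1 u) (hv.toL1 v) = ∫ ω, |u ω - v ω| ∂P := by
    intro u v hu hv
    rw [dist_eq_norm, ← Integrable.toL1_sub u v hu hv, L1.norm_eq_integral_norm]
    refine integral_congr_ae ?_
    filter_upwards [(hu.sub hv).coeFn_toL1] with ω hω
    rw [hω, Real.norm_eq_abs, Pi.sub_apply]
  have hcauchy : CauchySeq fun n => (hf n).toL1 (f n) :=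
    cauchySeq_of_le_tendsto_0' b (fun n n' h => (hdist _ _).trans_le (hfb n n' h)) hb
  obtain ⟨G, hG⟩ := cauchySeq_tendsto_of_complete hcauchy
  have hGint : Integrable G P := L1.integrable_coeFn G
  have hGeq : ∀ n, dist ((hf n).toL1 (f n)) G = ∫ ω, |f n ω - G ω| ∂P := by
    intro n
    rw [← hdist (hf n) hGint, Integrable.toL1_coeFn]
  refine ⟨G, hGint, ?_, fun n => ?_⟩
  · simpa only [hGeq] using tendsto_iff_dist_tendsto_zero.1 hG
  · rw [← hGeq]
    refine le_of_tendsto (tendsto_const_nhds.dist hG) ?_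
    filter_upwards [eventually_ge_atTop n] with n' h
    exact (hdist _ _).trans_le (hfb n n' h)

/-- Truncated sums of a doubly indexed family approximate the series of its limits, with an
error controlled by the tails of the approximation rate `φ` and of the majorant `ψ`. -/
theorem abs_sum_sub_tsum_le_tail_add_tail {a : ℕ → ℕ → ℝ} {d φ ψ : ℕ → ℝ} {c : ℝ} (hc : 0 ≤ c)
    (hφ0 : ∀ j, 0 ≤ φ j) (hψ0 : ∀ j, 0 ≤ ψ j) (hφ : Summable φ) (hψ : Summable ψ)
    (ha : ∀ k ℓ, k ≤ ℓ → |a k ℓ| ≤ c * ψ k) (hd : ∀ k, |d k| ≤ c * ψ k)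
    (had : ∀ k ℓ, k ≤ ℓ → |a k ℓ - d k| ≤ 2 * c * φ (ℓ - k)) {h m : ℕ} (hm : h ≤ m) :
    |(∑ k ∈ Finset.Icc 1 m, a k m) - ∑' k, d (k + 1)|
      ≤ 2 * c * ((∑' j, φ (m - h + j)) + ∑' j, ψ (h + j)) := by
  have hφs : Summable fun j => φ (m - h + j) := hφ.comp_injective (add_right_injective _)
  have hψs : Summable fun j => ψ (h + j) := hψ.comp_injective (add_right_injective _)
  have hψs' : Summable fun j => ψ (h + j + 1) := (summable_nat_add_iff 1).2 hψs
  have hψle : ∑' j, ψ (h + j + 1) ≤ ∑' j, ψ (h + j) := by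
    rw [hψs.tsum_eq_zero_add]
    exact le_add_of_nonneg_left (hψ0 _)
  have hds : Summable fun k => d (k + 1) :=
    .of_norm_bounded (((summable_nat_add_iff 1).2 hψ).mul_left c) fun k => hd (k + 1)
  have hsum : ∑ k ∈ Finset.Icc 1 m, a k m = (∑ k ∈ Finset.range h, a (k + 1) m)
      + ∑ i ∈ Finset.range (m - h), a (h + i + 1) m := by
    rw [← Finset.sum_range_add (fun k => a (k + 1) m), Nat.add_sub_cancel' hm,
      Finset.range_eq_Ico, Finset.sum_Ico_add' (fun k => a k m) 0 m 1]
    rfl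
  have htsum : ∑' k, d (k + 1) = (∑ k ∈ Finset.range h, d (k + 1)) + ∑' i, d (h + i + 1) := by
    rw [← hds.sum_add_tsum_nat_add h]
    simp only [add_comm h]
  have hhead : |∑ k ∈ Finset.range h, (a (k + 1) m - d (k + 1))|
      ≤ 2 * c * ∑' j, φ (m - h + j) := by
    calc _ ≤ ∑ k ∈ Finset.range h, 2 * c * φ (m - (k + 1)) := by
          refine (Finset.abs_sum_le_sum_abs _ _).trans (Finset.sum_le_sum fun k hk => ?_)
          have := Finset.mem_range.1 hk
          exact had _ _ (by omega)
      _ = 2 * c * ∑ j ∈ Finset.range h, φ (m - h + j) := by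
          rw [← Finset.mul_sum, ← Finset.sum_range_reflect (fun j => φ (m - h + j))]
          refine congrArg _ (Finset.sum_congr rfl fun k hk => congrArg φ ?_)
          have := Finset.mem_range.1 hk
          omega
      _ ≤ _ := by
          gcongr
          exact hφs.sum_le_tsum _ fun j _ => hφ0 _
  have hmid : |∑ i ∈ Finset.range (m - h), a (h + i + 1) m| ≤ c * ∑' j, ψ (h + j) := by
    calc _ ≤ ∑ i ∈ Finset.range (m - h), c * ψ (h + i + 1) := by
          refine (Finset.abs_sum_le_sum_abs _ _).trans (Finset.sum_le_sum fun k hk => ?_)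
          have := Finset.mem_range.1 hk
          exact ha _ _ (by omega)
      _ ≤ c * ∑' j, ψ (h + j) := by
          rw [← Finset.mul_sum]
          gcongr
          exact (hψs'.sum_le_tsum _ fun j _ => hψ0 _).trans hψle
  have htail : |∑' i, d (h + i + 1)| ≤ c * ∑' j, ψ (h + j) :=
    (tsum_of_norm_bounded (f := fun i => d (h + i + 1)) (hψs'.hasSum.mul_left c)
      fun i => hd (h + i + 1)).trans
        (mul_le_mul_of_nonneg_left hψle hc)
  rw [Finset.sum_sub_distrib] at hhead
  rw [hsum, htsum]
  rw [abs_le] at *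
  constructor <;> linarith [hhead.1, hhead.2, hmid.1, hmid.2, htail.1, htail.2]

/-- Abstract form of Lemma 4 (series approximation).  `A k ℓ` plays the role of
`H_{−k}(Y_{−ℓ:0})` and `B k ℓ` that of `H_{−k}(Y_{−ℓ:−1})` (for `ℓ ≥ k`), with the
forgetting bounds `E|A k ℓ − A k ℓ'| ≤ c φ_{ℓ−k}`, `E|B k ℓ − B k ℓ'| ≤ c φ_{ℓ−k}` and
`E|A k ℓ − B k ℓ| ≤ c ψ_k`, where `∑ φ` and `∑ ψ` converge.  Then the `L¹` limits
`A∞ k`, `B∞ k` exist, the series `∑_{k≥1} E[A∞ k − B∞ k]` converges absolutely, and the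
truncated sums approximate it with error controlled by the tails of `φ` and `ψ` past
`⌈m/2⌉` and `⌊m/2⌋`. -/
theorem series_approximation_lemma
    {Ω : Type*} [MeasurableSpace Ω] (P : Measure Ω) [IsProbabilityMeasure P]
    (A B : ℕ → ℕ → Ω → ℝ)
    (hint : ∀ k ℓ, Integrable (A k ℓ) P ∧ Integrable (B k ℓ) P)
    (c : ℝ) (hc : 0 ≤ c)
    (φ ψ : ℕ → ℝ) (hφ0 : ∀ j, 0 ≤ φ j) (hψ0 : ∀ j, 0 ≤ ψ j)
    (hφ : Summable φ) (hψ : Summable ψ)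
    (hpastA : ∀ k ℓ ℓ', k ≤ ℓ → ℓ ≤ ℓ' →
      ∫ ω, |A k ℓ ω - A k ℓ' ω| ∂P ≤ c * φ (ℓ - k))
    (hpastB : ∀ k ℓ ℓ', k ≤ ℓ → ℓ ≤ ℓ' →
      ∫ ω, |B k ℓ ω - B k ℓ' ω| ∂P ≤ c * φ (ℓ - k))
    (hfut : ∀ k ℓ, k ≤ ℓ → ∫ ω, |A k ℓ ω - B k ℓ ω| ∂P ≤ c * ψ k) :
    ∃ Ainf Binf : ℕ → Ω → ℝ,
      (∀ k, Integrable (Ainf k) P ∧ Integrable (Binf k) P)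
      ∧ (∀ k, Tendsto (fun ℓ => ∫ ω, |A k ℓ ω - Ainf k ω| ∂P) atTop (nhds 0))
      ∧ (∀ k, Tendsto (fun ℓ => ∫ ω, |B k ℓ ω - Binf k ω| ∂P) atTop (nhds 0))
      ∧ Summable (fun k : ℕ => |∫ ω, (Ainf (k + 1) ω - Binf (k + 1) ω) ∂P|)
      ∧ ∃ c' : ℝ, 0 ≤ c' ∧ ∀ m : ℕ, 1 ≤ m →
          |(∑ k ∈ Finset.Icc 1 m, ∫ ω, (A k m ω - B k m ω) ∂P)
              - ∑' k : ℕ, ∫ ω, (Ainf (k + 1) ω - Binf (k + 1) ω) ∂P|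
            ≤ c' * ((∑' j : ℕ, φ ((m + 1) / 2 + j)) + ∑' j : ℕ, ψ (m / 2 + j)) := by
  have hrate : Tendsto (fun n => c * φ n) atTop (nhds 0) := by
    simpa using hφ.tendsto_atTop_zero.const_mul c
  have hlim : ∀ F : ℕ → ℕ → Ω → ℝ, (∀ k ℓ, Integrable (F k ℓ) P) →
      (∀ k ℓ ℓ', k ≤ ℓ → ℓ ≤ ℓ' → ∫ ω, |F k ℓ ω - F k ℓ' ω| ∂P ≤ c * φ (ℓ - k)) →
      ∀ k, ∃ g : Ω → ℝ, Integrable g P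
        ∧ Tendsto (fun ℓ => ∫ ω, |F k ℓ ω - g ω| ∂P) atTop (nhds 0)
        ∧ ∀ ℓ, k ≤ ℓ → ∫ ω, |F k ℓ ω - g ω| ∂P ≤ c * φ (ℓ - k) := by
    intro F hF hpast k
    obtain ⟨g, hg, hgt, hgb⟩ := exists_integrable_limit_of_integral_abs_sub_le
      (fun n => hF k (n + k)) hrate fun n n' h => by
        simpa using hpast k (n + k) (n' + k) (by omega) (by omega)
    refine ⟨g, hg, (tendsto_add_atTop_iff_nat k).1 hgt, fun ℓ hℓ => ?_⟩
    simpa [Nat.sub_add_cancel hℓ] using hgb (ℓ - k)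
  choose Ainf hAi hAt hAb using hlim A (fun k ℓ => (hint k ℓ).1) hpastA
  choose Binf hBi hBt hBb using hlim B (fun k ℓ => (hint k ℓ).2) hpastB
  have ha : ∀ k ℓ, k ≤ ℓ → |∫ ω, (A k ℓ ω - B k ℓ ω) ∂P| ≤ c * ψ k := fun k ℓ h =>
    abs_integral_le_integral_abs.trans (hfut k ℓ h)
  have hdiff : ∀ k ℓ, |(∫ ω, (A k ℓ ω - B k ℓ ω) ∂P) - ∫ ω, (Ainf k ω - Binf k ω) ∂P|
      ≤ (∫ ω, |A k ℓ ω - Ainf k ω| ∂P) + ∫ ω, |B k ℓ ω - Binf k ω| ∂P := by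
    intro k ℓ
    have hA := (hint k ℓ).1
    have hB := (hint k ℓ).2
    have heq : (∫ ω, (A k ℓ ω - B k ℓ ω) ∂P) - ∫ ω, (Ainf k ω - Binf k ω) ∂P
        = (∫ ω, (A k ℓ ω - Ainf k ω) ∂P) - ∫ ω, (B k ℓ ω - Binf k ω) ∂P := by
      rw [integral_sub hA hB, integral_sub (hAi k) (hBi k), integral_sub hA (hAi k),
        integral_sub hB (hBi k)]
      ring
    rw [heq]
    exact (abs_sub _ _).trans
      (add_le_add abs_integral_le_integral_abs abs_integral_le_integral_abs)
  have hd : ∀ k, |∫ ω, (Ainf k ω - Binf k ω) ∂P| ≤ c * ψ k := by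
    intro k
    have hto : Tendsto (fun ℓ => ∫ ω, (A k ℓ ω - B k ℓ ω) ∂P) atTop
        (nhds (∫ ω, (Ainf k ω - Binf k ω) ∂P)) := by
      rw [tendsto_iff_dist_tendsto_zero]
      exact squeeze_zero (fun _ => dist_nonneg) (hdiff k) (by simpa using (hAt k).add (hBt k))
    refine le_of_tendsto hto.abs ?_
    filter_upwards [eventually_ge_atTop k] with ℓ h
    exact ha k ℓ h
  refine ⟨Ainf, Binf, fun k => ⟨hAi k, hBi k⟩, hAt, hBt, ?_, 2 * c, by positivity, fun m _ => ?_⟩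
  · exact .of_nonneg_of_le (fun _ => abs_nonneg _) (fun k => hd (k + 1))
      (((summable_nat_add_iff 1).2 hψ).mul_left c)
  · have hceil : (m + 1) / 2 = m - m / 2 := by omega
    rw [hceil]
    exact abs_sum_sub_tsum_le_tail_add_tail (a := fun k ℓ => ∫ ω, (A k ℓ ω - B k ℓ ω) ∂P)
      (d := fun k => ∫ ω, (Ainf k ω - Binf k ω) ∂P) hc hφ0 hψ0 hφ hψ ha hd
      (fun k ℓ h => (hdiff k ℓ).trans (by linarith [hAb k ℓ h, hBb k ℓ h])) (Nat.div_le_self m 2)
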